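/- For each of the Banach spaces Ω ∈ { c_0, c, l^α for 1 < α < ∞ } of complex sequences indexed by the nonnegative integers, the residual spectrum of the transition operator S acting on Ω is empty. -/

import Mathlib

open Filter Finset
open scoped ENNReal Topology ZeroAtInfty

noncomputable section

namespace AMFC

/-- `q d j = d 0 * d 1 * ... * d j`. -/
def q (d : ℕ → ℕ) (j : ℕ) : ℕ := ∏ i ∈ Finset.range (j + 1), d i

/-- For `j ≥ 1`, `digit d n j = ⌊n / q_{j-1}⌋ mod d_j` is the `j`-th digit of `n`
in the Cantor system of numeration. -/
def digit (d : ℕ → ℕ) (n j : ℕ) : ℕ := (n / q d (j - 1)) % d j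

/-- The counter `ζ_n = min { j ≥ 1 : a_j(n) ≠ d_j - 1 }`. -/
def zeta (d : ℕ → ℕ) (n : ℕ) : ℕ := sInf {j | 1 ≤ j ∧ digit d n j ≠ d j - 1}

open scoped Classical in
/-- The transition probabilities of the stochastic adding machine. -/
def s (d : ℕ → ℕ) (p : ℕ → ℝ) (n m : ℕ) : ℝ :=
  if m = n + 1 then ∏ j ∈ Finset.Icc 1 (zeta d n), p j
  else if m = n then 1 - p 1
  else if h : ∃ r, 1 ≤ r ∧ r + 1 ≤ zeta d n ∧
      n = m + ∑ j ∈ Finset.Icc 1 r, (d j - 1) * q d (j - 1)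
    then (1 - p (h.choose + 1)) * ∏ j ∈ Finset.Icc 1 h.choose, p j
  else 0

/-- `f j (z) = ((z - (1 - p j)) / p j) ^ (d j)`. -/
def f (d : ℕ → ℕ) (p : ℕ → ℝ) (j : ℕ) (z : ℂ) : ℂ :=
  ((z - (1 - (p j : ℂ))) / (p j : ℂ)) ^ d j

/-- `ftil j = f j ∘ ... ∘ f 1`, with `ftil 0 = id`. -/
def ftil (d : ℕ → ℕ) (p : ℕ → ℝ) : ℕ → ℂ → ℂ
  | 0 => id
  | j + 1 => f d p (j + 1) ∘ ftil d p j

/-- The fibered filled Julia set `E = {z : limsup_j |ftil j z| < ∞}`. -/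
def E (d : ℕ → ℕ) (p : ℕ → ℝ) : Set ℂ :=
  {z | Filter.limsup (fun j => (‖ftil d p j z‖₊ : ℝ≥0∞)) Filter.atTop < ⊤}

/-- `ι_λ(r) = (ftil (r-1) λ - (1 - p r)) / p r` for `r ≥ 1`. -/
def iota (d : ℕ → ℕ) (p : ℕ → ℝ) (lam : ℂ) (r : ℕ) : ℂ :=
  (ftil d p (r - 1) lam - (1 - (p r : ℂ))) / (p r : ℂ)

/-- `v_λ(n) = ∏_{r ≥ 1} ι_λ(r) ^ a_r(n)`, a finite product. -/
def vlam (d : ℕ → ℕ) (p : ℕ → ℝ) (lam : ℂ) (n : ℕ) : ℂ :=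
  ∏ᶠ r : ℕ, iota d p lam (r + 1) ^ digit d n (r + 1)

/-- The point spectrum of a continuous linear operator. -/
def pointSpectrum {M : Type*} [NormedAddCommGroup M] [NormedSpace ℂ M]
    (T : M →L[ℂ] M) : Set ℂ :=
  {lam | ∃ v, v ≠ 0 ∧ T v = lam • v}

/-- The residual spectrum: `T - λI` is injective but its range is not dense. -/
def residualSpectrum {M : Type*} [NormedAddCommGroup M] [NormedSpace ℂ M]
    (T : M →L[ℂ] M) : Set ℂ :=
  {lam | Function.Injective ⇑(T - lam • (1 : M →L[ℂ] M)) ∧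
    ¬ DenseRange ⇑(T - lam • (1 : M →L[ℂ] M))}

/-- The continuous spectrum: `T - λI` is injective with dense range, but not surjective. -/
def continuousSpectrum {M : Type*} [NormedAddCommGroup M] [NormedSpace ℂ M]
    (T : M →L[ℂ] M) : Set ℂ :=
  {lam | Function.Injective ⇑(T - lam • (1 : M →L[ℂ] M)) ∧
    DenseRange ⇑(T - lam • (1 : M →L[ℂ] M)) ∧
    Set.range ⇑(T - lam • (1 : M →L[ℂ] M)) ≠ Set.univ}

/-- partial products of the `p j`. -/
def PP (p : ℕ → ℝ) (j : ℕ) : ℝ := ∏ i ∈ Finset.Icc 1 j, p i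

lemma PP_succ (p : ℕ → ℝ) (j : ℕ) : PP p (j + 1) = PP p j * p (j + 1) := by
  unfold PP
  rw [Finset.prod_Icc_succ_top (by omega)]

lemma PP_zero (p : ℕ → ℝ) : PP p 0 = 1 := by simp [PP]

lemma PP_pos (p : ℕ → ℝ) (hp : ∀ j, 1 ≤ j → p j ∈ Set.Ioc (0 : ℝ) 1) (j : ℕ) :
    0 < PP p j := by
  unfold PP
  exact Finset.prod_pos fun i hi => (hp i (Finset.mem_Icc.1 hi).1).1

lemma PP_anti (p : ℕ → ℝ) (hp : ∀ j, 1 ≤ j → p j ∈ Set.Ioc (0 : ℝ) 1) (j : ℕ) :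
    PP p (j + 1) ≤ PP p j := by
  rw [PP_succ]
  exact mul_le_of_le_one_right (PP_pos p hp j).le (hp (j + 1) (by omega)).2

lemma PP_sum_le (p : ℕ → ℝ) (hp : ∀ j, 1 ≤ j → p j ∈ Set.Ioc (0 : ℝ) 1) (r n : ℕ) :
    ∑ s ∈ Finset.range n, (PP p (s + r) - PP p (s + r + 1)) ≤ PP p r := by
  have h : ∑ s ∈ Finset.range n, (PP p (s + r) - PP p (s + r + 1)) = PP p r - PP p (n + r) := by
    have := Finset.sum_range_sub' (fun s => PP p (s + r)) n
    simp only [zero_add] at this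
    rw [← this]
    refine Finset.sum_congr rfl fun s _ => ?_
    rw [show s + 1 + r = s + r + 1 by omega]
  rw [h]
  linarith [PP_pos p hp (n + r)]

lemma PP_summable (p : ℕ → ℝ) (hp : ∀ j, 1 ≤ j → p j ∈ Set.Ioc (0 : ℝ) 1) (r : ℕ) :
    Summable fun s => PP p (s + r) - PP p (s + r + 1) :=
  summable_of_sum_range_le (fun s => sub_nonneg.2 (PP_anti p hp _)) (PP_sum_le p hp r)

lemma PP_tsum_le (p : ℕ → ℝ) (hp : ∀ j, 1 ≤ j → p j ∈ Set.Ioc (0 : ℝ) 1) (r : ℕ) :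
    ∑' s, (PP p (s + r) - PP p (s + r + 1)) ≤ PP p r :=
  Real.tsum_le_of_sum_range_le (fun s => sub_nonneg.2 (PP_anti p hp _)) (PP_sum_le p hp r)

lemma q_succ (d : ℕ → ℕ) (j : ℕ) : q d (j + 1) = q d j * d (j + 1) := by
  unfold q
  rw [Finset.prod_range_succ]

lemma q_zero (d : ℕ → ℕ) (hd0 : d 0 = 1) : q d 0 = 1 := by simp [q, hd0]

lemma q_pos (d : ℕ → ℕ) (hd0 : d 0 = 1) (hd : ∀ j, 1 ≤ j → 2 ≤ d j) (j : ℕ) : 0 < q d j := by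
  induction j with
  | zero => rw [q_zero d hd0]; norm_num
  | succ j ih => rw [q_succ]; exact Nat.mul_pos ih (by have := hd (j + 1) (by omega); omega)

lemma q_strictMono (d : ℕ → ℕ) (hd0 : d 0 = 1) (hd : ∀ j, 1 ≤ j → 2 ≤ d j) :
    StrictMono (q d) := by
  refine strictMono_nat_of_lt_succ fun j => ?_
  rw [q_succ]
  have := q_pos d hd0 hd j
  have := hd (j + 1) (by omega)
  nlinarith

lemma sum_q (d : ℕ → ℕ) (hd0 : d 0 = 1) (hd : ∀ j, 1 ≤ j → 2 ≤ d j) (r : ℕ) :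
    ∑ j ∈ Finset.Icc 1 r, (d j - 1) * q d (j - 1) = q d r - 1 := by
  induction r with
  | zero => simp [q_zero d hd0]
  | succ r ih =>
    rw [Finset.sum_Icc_succ_top (by omega), ih, q_succ]
    have h1 := q_pos d hd0 hd r
    have h2 := hd (r + 1) (by omega)
    obtain ⟨k, hk⟩ := Nat.exists_eq_add_of_le h2
    rw [hk]
    simp only [Nat.add_sub_cancel]
    have : q d r * (2 + k) = (2 + k - 1) * q d r + q d r := by
      rw [show 2 + k - 1 = 1 + k by omega]; ring
    omega

lemma dvd_step (d : ℕ → ℕ) (hd0 : d 0 = 1) (hd : ∀ j, 1 ≤ j → 2 ≤ d j) (n r : ℕ) :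
    q d (r + 1) ∣ n + 1 ↔ q d r ∣ n + 1 ∧ digit d n (r + 1) = d (r + 1) - 1 := by
  have h1 := q_pos d hd0 hd r
  have h2 := hd (r + 1) (by omega)
  have key : q d r ∣ n + 1 → (q d (r + 1) ∣ n + 1 ↔ digit d n (r + 1) = d (r + 1) - 1) := by
    rintro ⟨t, ht⟩
    have ht0 : t ≠ 0 := by rintro rfl; simp at ht
    obtain ⟨u, rfl⟩ := Nat.exists_eq_succ_of_ne_zero ht0
    have hn : n / q d r = u := by
      apply Nat.div_eq_of_lt_le <;> nlinarith
    rw [ht, q_succ, Nat.mul_dvd_mul_iff_left h1]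
    unfold digit
    simp only [Nat.add_sub_cancel]
    rw [hn, Nat.dvd_iff_mod_eq_zero]
    have hlt := Nat.mod_lt u (show 0 < d (r + 1) by omega)
    rw [Nat.succ_eq_add_one, Nat.add_mod, Nat.mod_eq_of_lt (show 1 < d (r + 1) by omega)]
    constructor
    · intro h
      by_contra hne
      rw [Nat.mod_eq_of_lt (by omega)] at h
      omega
    · intro h
      rw [h, Nat.sub_add_cancel (by omega), Nat.mod_self]
  constructor
  · intro h
    have h' : q d r ∣ n + 1 := dvd_trans ⟨_, q_succ d r⟩ h
    exact ⟨h', (key h').1 h⟩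
  · rintro ⟨h', h⟩
    exact (key h').2 h

lemma dvd_iff (d : ℕ → ℕ) (hd0 : d 0 = 1) (hd : ∀ j, 1 ≤ j → 2 ≤ d j) (n r : ℕ) :
    q d r ∣ n + 1 ↔ ∀ j, 1 ≤ j → j ≤ r → digit d n j = d j - 1 := by
  induction r with
  | zero =>
    rw [q_zero d hd0]
    simp only [one_dvd, true_iff]
    intro j h1 h2
    omega
  | succ r ih =>
    rw [dvd_step d hd0 hd, ih]
    constructor
    · rintro ⟨h1, h2⟩ j hj hjr
      rcases Nat.lt_or_ge j (r + 1) with h | h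
      · exact h1 j hj (by omega)
      · obtain rfl : j = r + 1 := by omega
        exact h2
    · intro h
      exact ⟨fun j hj hjr => h j hj (by omega), h _ (by omega) le_rfl⟩

lemma zeta_iff (d : ℕ → ℕ) (hd0 : d 0 = 1) (hd : ∀ j, 1 ≤ j → 2 ≤ d j) (n r : ℕ) :
    r + 1 ≤ zeta d n ↔ q d r ∣ n + 1 := by
  have hne : {j | 1 ≤ j ∧ digit d n j ≠ d j - 1}.Nonempty := by
    by_contra hemp
    rw [Set.not_nonempty_iff_eq_empty, Set.eq_empty_iff_forall_notMem] at hemp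
    have h : q d (n + 2) ∣ n + 1 := by
      rw [dvd_iff d hd0 hd]
      intro j hj _
      by_contra h
      exact hemp j ⟨hj, h⟩
    have := Nat.le_of_dvd (by omega) h
    have := (q_strictMono d hd0 hd).le_apply (x := n + 2)
    omega
  rw [dvd_iff d hd0 hd]
  constructor
  · intro h j hj hjr
    by_contra hc
    have : zeta d n ≤ j := Nat.sInf_le (show j ∈ {j | 1 ≤ j ∧ digit d n j ≠ d j - 1} from ⟨hj, hc⟩)
    omega
  · intro h
    have hm := Nat.sInf_mem hne
    by_contra hc
    exact hm.2 (h _ hm.1 (by unfold zeta at hc; omega))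

lemma zeta_eq (d : ℕ → ℕ) (hd0 : d 0 = 1) (hd : ∀ j, 1 ≤ j → 2 ≤ d j) (n r : ℕ)
    (h1 : q d r ∣ n + 1) (h2 : ¬ q d (r + 1) ∣ n + 1) : zeta d n = r + 1 := by
  rw [← zeta_iff d hd0 hd] at h1 h2
  omega

/-- Explicit form of the entries. -/
lemma s_eq (d : ℕ → ℕ) (p : ℕ → ℝ) (hd0 : d 0 = 1) (hd : ∀ j, 1 ≤ j → 2 ≤ d j) (n m : ℕ) :
    s d p n m = (if m = n + 1 then PP p (zeta d n) else 0) + (if m = n then 1 - p 1 else 0) +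
      ∑' t : ℕ, (if q d (t + 1) ∣ m then (PP p (t + 1) - PP p (t + 2)) else 0) *
        (if n = m + q d (t + 1) - 1 then 1 else 0) := by
  have hq1 : ∀ t, 2 ≤ q d (t + 1) := fun t => by
    have := q_strictMono d hd0 hd (show 0 < t + 1 by omega)
    rw [q_zero d hd0] at this
    omega
  by_cases hA : m < n
  · have e1 : m ≠ n + 1 := by omega
    have e2 : m ≠ n := by omega
    unfold s
    simp only [if_neg e1, if_neg e2, zero_add]
    split_ifs with h
    · obtain ⟨c1, c2, c3⟩ := h.choose_spec
      set r := h.choose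
      rw [sum_q d hd0 hd] at c3
      obtain ⟨t, ht⟩ : ∃ t, r = t + 1 := ⟨r - 1, by omega⟩
      rw [ht] at c2 c3 ⊢
      have hq := hq1 t
      rw [zeta_iff d hd0 hd] at c2
      have hdv : q d (t + 1) ∣ m := by
        rw [c3, show m + (q d (t + 1) - 1) + 1 = m + q d (t + 1) by omega] at c2
        simpa using c2
      rw [tsum_eq_single t]
      · rw [if_pos hdv, if_pos (by omega), PP_succ p (t + 1)]
        simp only [PP]
        ring
      · intro b hb
        rw [if_neg (c := n = _), mul_zero]
        intro hc
        apply hb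
        have : q d (b + 1) = q d (t + 1) := by have := hq1 b; omega
        have := (q_strictMono d hd0 hd).injective this
        omega
    · symm
      convert tsum_zero with t
      split_ifs with h1 h2
      · exfalso
        apply h
        refine ⟨t + 1, by omega, ?_, ?_⟩
        · rw [zeta_iff d hd0 hd, h2]
          have := hq1 t
          rw [show m + q d (t + 1) - 1 + 1 = m + q d (t + 1) by omega]
          simpa using h1
        · rw [sum_q d hd0 hd]
          have := hq1 t
          omega
      all_goals simp
  · have hz : ∑' t : ℕ, (if q d (t + 1) ∣ m then (PP p (t + 1) - PP p (t + 2)) else 0) *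
        (if n = m + q d (t + 1) - 1 then (1:ℝ) else 0) = 0 := by
      convert tsum_zero with t
      rw [if_neg (c := n = _), mul_zero]
      have := hq1 t
      omega
    rw [hz]
    unfold s
    by_cases e1 : m = n + 1
    · have e2 : m ≠ n := by omega
      simp [e1, PP]
    · by_cases e2 : m = n
      · simp [e2]
      · simp only [if_neg e1, if_neg e2]
        rw [dif_neg]
        · simp
        · rintro ⟨r, h1, h2, h3⟩
          omega

/-- general term of the column sums. -/
def colT (d : ℕ → ℕ) (p : ℕ → ℝ) (μ : ℕ → ℂ) (m r t : ℕ) : ℂ :=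
  if q d (t + r + 1) ∣ m then
    ((PP p (t + r + 1) - PP p (t + r + 2) : ℝ) : ℂ) * μ (m + q d (t + r + 1) - 1) else 0

lemma colT_summable (d : ℕ → ℕ) (p : ℕ → ℝ) (hp : ∀ j, 1 ≤ j → p j ∈ Set.Ioc (0 : ℝ) 1)
    (μ : ℕ → ℂ) (C : ℝ) (hC : ∀ n, ‖μ n‖ ≤ C) (m r : ℕ) : Summable (colT d p μ m r) := by
  refine Summable.of_norm_bounded ((PP_summable p hp (r + 1)).mul_right C) fun t => ?_
  have h0 : 0 ≤ PP p (t + (r + 1)) - PP p (t + (r + 1) + 1) := sub_nonneg.2 (PP_anti p hp _)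
  have hC0 : 0 ≤ C := (norm_nonneg _).trans (hC 0)
  unfold colT
  split_ifs
  · rw [norm_mul, Complex.norm_real]
    change ‖PP p (t + (r + 1)) - PP p (t + (r + 1) + 1)‖ * _ ≤ _
    rw [Real.norm_of_nonneg h0]
    exact mul_le_mul_of_nonneg_left (hC _) h0
  · rw [norm_zero]; positivity

lemma iota_succ (d : ℕ → ℕ) (p : ℕ → ℝ) (hp : ∀ j, 1 ≤ j → p j ∈ Set.Ioc (0 : ℝ) 1)
    (lam : ℂ) (r : ℕ) :
    (p (r + 1) : ℂ) * iota d p lam (r + 1) = ftil d p r lam - (1 - (p (r + 1) : ℂ)) := by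
  have : (p (r + 1) : ℂ) ≠ 0 := by exact_mod_cast (hp (r + 1) (by omega)).1.ne'
  unfold iota
  simp only [Nat.add_sub_cancel]
  field_simp

lemma ftil_succ (d : ℕ → ℕ) (p : ℕ → ℝ) (lam : ℂ) (r : ℕ) :
    ftil d p (r + 1) lam = iota d p lam (r + 1) ^ d (r + 1) := rfl

/-- The level `r` column relation. -/
def colRel (d : ℕ → ℕ) (p : ℕ → ℝ) (lam : ℂ) (μ : ℕ → ℂ) (r : ℕ) : Prop :=
  ∀ m, q d r ∣ m → (PP p (r + 1) : ℂ) * iota d p lam (r + 1) * μ (m + q d r - 1) =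
    (if m = 0 then 0 else (PP p (zeta d (m - 1)) : ℂ) * μ (m - 1)) + ∑' t, colT d p μ m r t

lemma colRel_block (d : ℕ → ℕ) (p : ℕ → ℝ) (hd0 : d 0 = 1) (hd : ∀ j, 1 ≤ j → 2 ≤ d j)
    (hp : ∀ j, 1 ≤ j → p j ∈ Set.Ioc (0 : ℝ) 1) (lam : ℂ) (μ : ℕ → ℂ) (r : ℕ)
    (h : colRel d p lam μ r) (m : ℕ) (h1 : q d r ∣ m) (h2 : ¬ q d (r + 1) ∣ m) :
    μ (m - 1) = iota d p lam (r + 1) * μ (m + q d r - 1) := by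
  have hm : m ≠ 0 := by rintro rfl; simp at h2
  have hr := h m h1
  have hz : ∀ t, colT d p μ m r t = 0 := fun t => by
    unfold colT
    rw [if_neg]
    intro hc
    exact h2 (dvd_trans (Finset.prod_dvd_prod_of_subset _ _ _ (by
      intro i hi; simp only [Finset.mem_range] at hi ⊢; omega)) hc)
  have hze : zeta d (m - 1) = r + 1 := by
    apply zeta_eq d hd0 hd <;> rwa [Nat.sub_add_cancel (by omega)]
  simp only [hz, tsum_zero, add_zero, if_neg hm, hze] at hr
  have hP : (PP p (r + 1) : ℂ) ≠ 0 := by exact_mod_cast (PP_pos p hp (r + 1)).ne'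
  rw [mul_assoc] at hr
  exact (mul_left_cancel₀ hP hr).symm

lemma colRel_block' (d : ℕ → ℕ) (p : ℕ → ℝ) (hd0 : d 0 = 1) (hd : ∀ j, 1 ≤ j → 2 ≤ d j)
    (hp : ∀ j, 1 ≤ j → p j ∈ Set.Ioc (0 : ℝ) 1) (lam : ℂ) (μ : ℕ → ℂ) (r : ℕ)
    (h : colRel d p lam μ r) (k : ℕ) (b : ℕ) (hb : b < d (r + 1)) :
    μ (q d r * (d (r + 1) * k + (d (r + 1) - 1 - b)) + q d r - 1) =
      iota d p lam (r + 1) ^ b * μ (q d (r + 1) * k + q d (r + 1) - 1) := by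
  have hq := q_pos d hd0 hd r
  induction b with
  | zero =>
    rw [pow_zero, one_mul, q_succ]
    congr 1
    obtain ⟨e, he⟩ := Nat.exists_eq_add_of_le' (show 1 ≤ d (r + 1) by omega)
    rw [he]
    simp only [Nat.add_sub_cancel, Nat.sub_zero]
    congr 1
    ring
  | succ b ih =>
    have ih' := ih (by omega)
    obtain ⟨e, he⟩ := Nat.exists_eq_add_of_le' (show 1 ≤ d (r + 1) - 1 - b by omega)
    have he2 : d (r + 1) - 1 - (b + 1) = e := by omega
    have hB := colRel_block d p hd0 hd hp lam μ r h
      (q d r * (d (r + 1) * k + (e + 1))) (dvd_mul_right _ _) (by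
        rw [q_succ, Nat.mul_dvd_mul_iff_left hq, ← Nat.dvd_add_iff_right (dvd_mul_right _ _)]
        intro hc
        have := Nat.le_of_dvd (by omega) hc
        omega)
    rw [he] at ih'
    rw [he2, pow_succ', mul_assoc, ← ih', ← hB]
    congr 1

lemma colRel_step (d : ℕ → ℕ) (p : ℕ → ℝ) (hd0 : d 0 = 1) (hd : ∀ j, 1 ≤ j → 2 ≤ d j)
    (hp : ∀ j, 1 ≤ j → p j ∈ Set.Ioc (0 : ℝ) 1) (lam : ℂ) (μ : ℕ → ℂ)
    (C : ℝ) (hC : ∀ n, ‖μ n‖ ≤ C) (r : ℕ)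
    (h : colRel d p lam μ r) : colRel d p lam μ (r + 1) := by
  intro m hm
  have hm' : q d r ∣ m := dvd_trans ⟨_, q_succ d r⟩ hm
  have hd1 := hd (r + 1) (by omega)
  have hr := h m hm'
  obtain ⟨k, rfl⟩ := hm
  have hb := colRel_block' d p hd0 hd hp lam μ r h k (d (r + 1) - 1) (by omega)
  rw [Nat.sub_self, add_zero, ← mul_assoc, ← q_succ] at hb
  rw [(colT_summable d p hp μ C hC _ r).tsum_eq_zero_add] at hr
  have hs : ∀ t, colT d p μ (q d (r + 1) * k) r (t + 1) =
      colT d p μ (q d (r + 1) * k) (r + 1) t := fun t => by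
    unfold colT
    rw [show t + 1 + r = t + (r + 1) by omega]
  simp only [hs] at hr
  have h0 : colT d p μ (q d (r + 1) * k) r 0 =
      ((PP p (r + 1) - PP p (r + 2) : ℝ) : ℂ) * μ (q d (r + 1) * k + q d (r + 1) - 1) := by
    unfold colT
    rw [zero_add, if_pos (dvd_mul_right _ _)]
  rw [h0, hb] at hr
  have hi := iota_succ d p hp lam (r + 1)
  rw [ftil_succ] at hi
  have hpow : iota d p lam (r + 1) ^ d (r + 1) =
      iota d p lam (r + 1) * iota d p lam (r + 1) ^ (d (r + 1) - 1) := by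
    rw [← pow_succ', Nat.sub_add_cancel (by omega)]
  rw [hpow] at hi
  have hP := PP_succ p (r + 1)
  rw [show r + 1 + 1 = r + 2 from rfl] at hi hP ⊢
  rw [hP] at hr ⊢
  push_cast at hr ⊢
  linear_combination hr + (PP p (r + 1) : ℂ) * μ (q d (r + 1) * k + q d (r + 1) - 1) * hi

lemma seq_main (d : ℕ → ℕ) (p : ℕ → ℝ) (hd0 : d 0 = 1) (hd : ∀ j, 1 ≤ j → 2 ≤ d j)
    (hp : ∀ j, 1 ≤ j → p j ∈ Set.Ioc (0 : ℝ) 1) (lam : ℂ) (μ : ℕ → ℂ)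
    (C : ℝ) (hC : ∀ n, ‖μ n‖ ≤ C) (h0 : colRel d p lam μ 0) :
    (∀ n, μ n = 0) ∨ ∃ r, ∃ δ > 0, ∀ t, r ≤ t → δ ≤ ‖μ (q d t - 1)‖ := by
  have hR : ∀ r, colRel d p lam μ r := fun r => by
    induction r with
    | zero => exact h0
    | succ r ih => exact colRel_step d p hd0 hd hp lam μ C hC r ih
  by_cases hx : ∀ t, μ (q d t - 1) = 0
  · left
    intro n
    have hlt : n + 1 ≤ q d (n + 1) := (q_strictMono d hd0 hd).le_apply
    have key : ∀ j r k, r + j = n + 1 → q d r * (k + 1) ≤ q d (n + 1) →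
        μ (q d r * k + q d r - 1) = 0 := by
      intro j
      induction j with
      | zero =>
        intro r k hr hk
        rw [add_zero] at hr
        subst hr
        have : k = 0 := by
          have := q_pos d hd0 hd (n + 1)
          by_contra hk0
          have : 1 ≤ k := by omega
          nlinarith
        subst this
        simpa using hx (n + 1)
      | succ j ih =>
        intro r k hr hk
        have hd1 := hd (r + 1) (by omega)
        have hmod := Nat.mod_lt k (show 0 < d (r + 1) by omega)
        have hb := colRel_block' d p hd0 hd hp lam μ r (hR r) (k / d (r + 1))
          (d (r + 1) - 1 - k % d (r + 1)) (by omega)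
        rw [show d (r + 1) - 1 - (d (r + 1) - 1 - k % d (r + 1)) = k % d (r + 1) by omega,
          Nat.div_add_mod] at hb
        rw [hb, ih (r + 1) _ (by omega), mul_zero]
        -- divisibility bound
        have hdv : q d (r + 1) ∣ q d (n + 1) :=
          Finset.prod_dvd_prod_of_subset _ _ _ (by
            intro i hi; simp only [Finset.mem_range] at hi ⊢; omega)
        obtain ⟨u, hu⟩ := hdv
        rw [hu]
        refine Nat.mul_le_mul_left _ ?_
        rw [hu, q_succ, mul_assoc] at hk
        have := Nat.le_of_mul_le_mul_left hk (q_pos d hd0 hd r)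
        rw [Nat.succ_le_iff, Nat.div_lt_iff_lt_mul (by omega)]
        rw [mul_comm]
        omega
    have := key (n + 1) 0 n (by omega) (by rw [q_zero d hd0]; omega)
    rw [q_zero d hd0] at this
    simpa using this
  · right
    push Not at hx
    obtain ⟨r, hr⟩ := hx
    set x : ℕ → ℂ := fun t => μ (q d t - 1) with hxdef
    have hx1 : ∀ t, x t = iota d p lam (t + 1) ^ (d (t + 1) - 1) * x (t + 1) := fun t => by
      have hd1 := hd (t + 1) (by omega)
      have := colRel_block' d p hd0 hd hp lam μ t (hR t) 0 (d (t + 1) - 1) (by omega)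
      simpa using this
    have hx2 : ∀ t, (PP p (t + 1) : ℂ) * iota d p lam (t + 1) * x t =
        ∑' u, ((PP p (u + (t + 1)) - PP p (u + (t + 1) + 1) : ℝ) : ℂ) * x (u + (t + 1)) :=
      fun t => by
        have := hR t 0 (dvd_zero _)
        simpa [colT, hxdef, add_assoc] using this
    have hxne : ∀ t, r ≤ t → x t ≠ 0 := by
      intro t ht
      induction t, ht using Nat.le_induction with
      | base => exact hr
      | succ t ht ih =>
        intro hc
        rw [hx1, hc, mul_zero] at ih
        exact ih rfl
    -- growth outside the unit disc
    have hgrow : ∀ t, 1 < ‖ftil d p t lam‖ → 1 < ‖iota d p lam (t + 1)‖ := by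
      intro t ht
      have hpp := hp (t + 1) (by omega)
      have hi := congrArg norm (iota_succ d p hp lam t)
      rw [norm_mul, Complex.norm_real, Real.norm_of_nonneg hpp.1.le] at hi
      have h1 := norm_sub_norm_le (ftil d p t lam) (1 - (p (t + 1) : ℂ))
      have h2 : ‖(1 - (p (t + 1) : ℂ))‖ = 1 - p (t + 1) := by
        rw [← Complex.ofReal_one, ← Complex.ofReal_sub, Complex.norm_real,
          Real.norm_of_nonneg (by linarith [hpp.2])]
      rw [h2, ← hi] at h1
      have h3 : p (t + 1) * 1 < p (t + 1) * ‖iota d p lam (t + 1)‖ := by linarith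
      exact lt_of_mul_lt_mul_left h3 hpp.1.le
    have hle : ∀ t, r ≤ t → ‖ftil d p t lam‖ ≤ 1 := by
      intro t ht
      by_contra hgt
      push Not at hgt
      have hall : ∀ u, t ≤ u → 1 < ‖ftil d p u lam‖ := by
        intro u hu
        induction u, hu using Nat.le_induction with
        | base => exact hgt
        | succ u hu ih =>
          rw [ftil_succ, norm_pow]
          exact one_lt_pow₀ (hgrow u ih) (by have := hd (u + 1) (by omega); omega)
      have hdec : ∀ u, t ≤ u → ‖x (u + 1)‖ ≤ ‖x u‖ := by
        intro u hu
        rw [hx1 u, norm_mul, norm_pow]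
        exact le_mul_of_one_le_left (norm_nonneg _) (one_le_pow₀ (hgrow u (hall u hu)).le)
      have hdec2 : ∀ u, ‖x (u + (t + 1))‖ ≤ ‖x t‖ := by
        intro u
        induction u with
        | zero => simpa using hdec t le_rfl
        | succ u ih =>
          rw [show u + 1 + (t + 1) = u + (t + 1) + 1 by omega]
          exact (hdec _ (by omega)).trans ih
      have hsum := (PP_summable p hp (t + 1)).mul_right ‖x t‖
      have hb : ‖∑' u, ((PP p (u + (t + 1)) - PP p (u + (t + 1) + 1) : ℝ) : ℂ) *
          x (u + (t + 1))‖ ≤ ∑' u, (PP p (u + (t + 1)) - PP p (u + (t + 1) + 1)) * ‖x t‖ := by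
        refine tsum_of_norm_bounded hsum.hasSum fun u => ?_
        have h0 : 0 ≤ PP p (u + (t + 1)) - PP p (u + (t + 1) + 1) :=
          sub_nonneg.2 (PP_anti p hp _)
        rw [norm_mul, Complex.norm_real, Real.norm_of_nonneg h0]
        exact mul_le_mul_of_nonneg_left (hdec2 u) h0
      rw [← hx2, tsum_mul_right, norm_mul, norm_mul, Complex.norm_real,
        Real.norm_of_nonneg (PP_pos p hp _).le] at hb
      have hxpos : 0 < ‖x t‖ := norm_pos_iff.2 (hxne t ht)
      have hb2 := le_of_mul_le_mul_right hb hxpos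
      have hb3 := hb2.trans (PP_tsum_le p hp (t + 1))
      have := hgrow t hgt
      have := PP_pos p hp (t + 1)
      nlinarith
    refine ⟨r, ‖x r‖, norm_pos_iff.2 hr, fun t ht => ?_⟩
    change ‖x r‖ ≤ ‖x t‖
    induction t, ht using Nat.le_induction with
    | base => exact le_rfl
    | succ t ht ih =>
      refine ih.trans ?_
      rw [hx1 t, norm_mul, norm_pow]
      refine mul_le_of_le_one_left (norm_nonneg _) (pow_le_one₀ (norm_nonneg _) ?_)
      have := hle (t + 1) (by omega)
      rw [ftil_succ, norm_pow] at this
      by_contra hc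
      push Not at hc
      have := one_lt_pow₀ hc (n := d (t + 1)) (by have := hd (t + 1) (by omega); omega)
      linarith

lemma exists_dual_of_not_dense {M : Type*} [NormedAddCommGroup M] [NormedSpace ℂ M]
    (T : M →L[ℂ] M) (h : ¬ DenseRange T) : ∃ φ : M →L[ℂ] ℂ, φ ≠ 0 ∧ ∀ w, φ (T w) = 0 := by
  set K : Submodule ℂ M := (LinearMap.range (T : M →ₗ[ℂ] M)).topologicalClosure with hK
  have hKc : IsClosed (K : Set M) := Submodule.isClosed_topologicalClosure _
  have : ∃ x, x ∉ K := by
    by_contra hc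
    push Not at hc
    apply h
    intro x
    have := hc x
    rw [hK, ← SetLike.mem_coe, Submodule.topologicalClosure_coe] at this
    exact this
  obtain ⟨x, hx⟩ := this
  have : IsClosed (K : Set M) := hKc
  obtain ⟨g, -, hg⟩ := exists_dual_vector ℂ (K.mkQ x) (by
    rw [norm_ne_zero_iff]
    simpa using hx)
  refine ⟨g.comp K.mkQL, ?_, ?_⟩
  · intro h0
    have : g (K.mkQ x) = 0 := congrArg (fun (φ : M →L[ℂ] ℂ) => φ x) h0
    rw [hg] at this
    apply hx
    simpa using this
  · intro w
    have : K.mkQ (T w) = 0 := by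
      simp only [Submodule.mkQ_apply, Submodule.Quotient.mk_eq_zero]
      exact Submodule.le_topologicalClosure _ ⟨w, rfl⟩
    change g (K.mkQ (T w)) = 0
    rw [this, map_zero]

lemma key {M : Type*} [NormedAddCommGroup M] [NormedSpace ℂ M] [CompleteSpace M]
    (d : ℕ → ℕ) (p : ℕ → ℝ) (hd0 : d 0 = 1) (hd : ∀ j, 1 ≤ j → 2 ≤ d j)
    (hp : ∀ j, 1 ≤ j → p j ∈ Set.Ioc (0 : ℝ) 1)
    (T : M →L[ℂ] M) (ev : ℕ → M →L[ℂ] ℂ) (hsep : ∀ w w', (∀ n, ev n w = ev n w') → w = w')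
    (e : ℕ → M) (he : ∀ n m, ev n (e m) = if n = m then 1 else 0)
    (γ : ℝ) (hγ : γ < 1)
    (hnorm : ∀ (F : Finset ℕ) (c : ℕ → ℂ), (∀ n, ‖c n‖ ≤ 1) →
      ‖∑ n ∈ F, c n • e n‖ ≤ (F.card : ℝ) ^ γ)
    (hT : ∀ w n, ev n (T w) = ∑' m, (s d p n m : ℂ) * ev m w)
    (φ : M →L[ℂ] ℂ) (lam : ℂ) (hφ : ∀ w, φ (T w) = lam * φ w) (n : ℕ) : φ (e n) = 0 := by
  have he1 : ∀ n, ‖e n‖ ≤ 1 := fun n => by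
    simpa using hnorm {n} (fun _ => 1) (by simp)
  have hTe : ∀ m n, ev n (T (e m)) = s d p n m := fun m n => by
    rw [hT, tsum_eq_single m]
    · simp [he]
    · intro b hb
      simp [he, hb]
  have hcol : colRel d p lam (fun n => φ (e n)) 0 := by
    intro m _
    set c : ℕ → ℝ := fun t => if q d (t + 1) ∣ m then (PP p (t + 1) - PP p (t + 2)) else 0 with hc
    have hsum : Summable fun t => (c t : ℂ) • e (m + q d (t + 1) - 1) := by
      refine Summable.of_norm_bounded (PP_summable p hp 1) fun t => ?_
      have h0 : 0 ≤ PP p (t + 1) - PP p (t + 1 + 1) := sub_nonneg.2 (PP_anti p hp _)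
      rw [norm_smul, Complex.norm_real]
      have : ‖c t‖ ≤ PP p (t + 1) - PP p (t + 1 + 1) := by
        simp only [hc]
        split_ifs
        · exact (Real.norm_of_nonneg h0).le
        · simpa using h0
      exact (mul_le_of_le_one_right (norm_nonneg _) (he1 _)).trans this
    have hdec : T (e m) = (if m = 0 then 0 else (PP p (zeta d (m - 1)) : ℂ) • e (m - 1)) +
        ((1 - p 1 : ℝ) : ℂ) • e m + ∑' t, (c t : ℂ) • e (m + q d (t + 1) - 1) := by
      apply hsep
      intro n
      rw [hTe, s_eq d p hd0 hd, map_add, map_add, (ev n).map_tsum hsum]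
      simp only [map_smul, he]
      push_cast
      congr 1
      · congr 1
        · rcases Nat.eq_zero_or_pos m with rfl | hm
          · simp
          · by_cases hmn : m = n + 1
            · subst hmn
              simp [he]
            · have : n ≠ m - 1 := by omega
              have hm0 : m ≠ 0 := by omega
              simp [he, hmn, this, hm0]
        · by_cases hmn : m = n
          · simp [hmn]
          · have : n ≠ m := fun h => hmn h.symm
            simp [hmn, this]
      · refine tsum_congr fun t => ?_
        simp only [hc, smul_eq_mul]
        split_ifs <;> simp
    have h1 := hφ (e m)
    rw [hdec, map_add, map_add, φ.map_tsum hsum] at h1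
    have hi := iota_succ d p hp lam 0
    have hP1 : PP p (0 + 1) = p (0 + 1) := by rw [PP_succ, PP_zero, one_mul]
    have ht : ∑' t, colT d p (fun n => φ (e n)) m 0 t =
        ∑' t, φ ((c t : ℂ) • e (m + q d (t + 1) - 1)) := by
      refine tsum_congr fun t => ?_
      simp only [colT, hc, map_smul, smul_eq_mul, add_zero]
      split_ifs <;> simp
    have hif : φ (if m = 0 then 0 else (PP p (zeta d (m - 1)) : ℂ) • e (m - 1)) =
        (if m = 0 then 0 else (PP p (zeta d (m - 1)) : ℂ) * φ (e (m - 1))) := by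
      split_ifs <;> simp
    rw [hif] at h1
    rw [ht, hP1, hi, q_zero d hd0]
    simp only [Nat.add_sub_cancel, map_smul, smul_eq_mul, zero_add, ftil, id] at h1 ⊢
    push_cast at h1
    linear_combination -h1
  rcases seq_main d p hd0 hd hp lam (fun n => φ (e n)) ‖φ‖
    (fun n => (φ.le_opNorm _).trans (mul_le_of_le_one_right (norm_nonneg _) (he1 n))) hcol with
    h | ⟨r, δ, hδ, h⟩
  · exact h n
  exfalso
  have hb : ∀ N : ℕ, N * δ ≤ ‖φ‖ * (N : ℝ) ^ γ := by
    intro N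
    have hinj : Function.Injective fun i => q d (r + i) - 1 := by
      intro i j hij
      have h1 := q_pos d hd0 hd (r + i)
      have h2 := q_pos d hd0 hd (r + j)
      simp only at hij
      have := (q_strictMono d hd0 hd).injective (show q d (r + i) = q d (r + j) by omega)
      omega
    set F : Finset ℕ := (Finset.range N).image fun i => q d (r + i) - 1 with hF
    have hcard : F.card = N := by
      rw [hF, Finset.card_image_of_injective _ hinj, Finset.card_range]
    set c : ℕ → ℂ := fun n => (starRingEnd ℂ) (φ (e n)) / (‖φ (e n)‖ : ℂ) with hc
    have hc1 : ∀ n, ‖c n‖ ≤ 1 := fun n => by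
      simp only [hc, norm_div, RCLike.norm_conj, Complex.norm_real, norm_norm]
      exact div_self_le_one _
    have hcφ : ∀ n, c n * φ (e n) = (‖φ (e n)‖ : ℂ) := fun n => by
      simp only [hc]
      by_cases h0 : φ (e n) = 0
      · simp [h0]
      · have : (‖φ (e n)‖ : ℂ) ≠ 0 := by simpa using h0
        field_simp
        rw [Complex.conj_mul']
    have h1 := hnorm F c hc1
    have h2 := φ.le_opNorm (∑ n ∈ F, c n • e n)
    rw [map_sum] at h2
    simp only [map_smul, smul_eq_mul, hcφ] at h2
    rw [← Complex.ofReal_sum, Complex.norm_real,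
      Real.norm_of_nonneg (Finset.sum_nonneg fun _ _ => norm_nonneg _)] at h2
    have h3 : F.card • δ ≤ ∑ n ∈ F, ‖φ (e n)‖ := by
      refine Finset.card_nsmul_le_sum _ _ _ fun n hn => ?_
      rw [hF, Finset.mem_image] at hn
      obtain ⟨i, -, rfl⟩ := hn
      exact h (r + i) (by omega)
    rw [hcard] at h1 h3
    rw [nsmul_eq_mul] at h3
    exact h3.trans (h2.trans (mul_le_mul_of_nonneg_left h1 (norm_nonneg _)))
  have ht : Tendsto (fun N : ℕ => (N : ℝ) ^ (1 - γ)) atTop atTop :=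
    (tendsto_rpow_atTop (by linarith)).comp tendsto_natCast_atTop_atTop
  obtain ⟨N, hN1, hN2⟩ := ((ht.eventually_gt_atTop (‖φ‖ / δ)).and (eventually_gt_atTop 0)).exists
  have hN0 : (0 : ℝ) < N := by exact_mod_cast hN2
  have hN := hb N
  rw [div_lt_iff₀ hδ] at hN1
  have hpos : 0 < (N : ℝ) ^ γ := Real.rpow_pos_of_pos hN0 γ
  have hsplit : (N : ℝ) ^ (1 - γ) * (N : ℝ) ^ γ = N := by
    rw [← Real.rpow_add hN0]
    simp
  nlinarith [mul_lt_mul_of_pos_right hN1 hpos]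

lemma sup_hnorm {M : Type*} [NormedAddCommGroup M] [NormedSpace ℂ M]
    (ev : ℕ → M →L[ℂ] ℂ) (e : ℕ → M) (he : ∀ n m, ev n (e m) = if n = m then 1 else 0)
    (hev : ∀ (w : M) (C : ℝ), 0 ≤ C → (∀ n, ‖ev n w‖ ≤ C) → ‖w‖ ≤ C)
    (F : Finset ℕ) (c : ℕ → ℂ) (hc : ∀ n, ‖c n‖ ≤ 1) :
    ‖∑ n ∈ F, c n • e n‖ ≤ (F.card : ℝ) ^ (0 : ℝ) := by
  rw [Real.rpow_zero]
  refine hev _ _ zero_le_one fun n => ?_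
  rw [map_sum]
  simp only [map_smul, he, smul_eq_mul, mul_ite, mul_one, mul_zero, Finset.sum_ite_eq]
  split_ifs
  · exact hc n
  · simp

lemma sup_zero {M : Type*} [NormedAddCommGroup M] [NormedSpace ℂ M]
    (ev : ℕ → M →L[ℂ] ℂ) (e : ℕ → M) (he : ∀ n m, ev n (e m) = if n = m then 1 else 0)
    (hev : ∀ (w : M) (C : ℝ), 0 ≤ C → (∀ n, ‖ev n w‖ ≤ C) → ‖w‖ ≤ C)
    (φ : M →L[ℂ] ℂ) (hφ : ∀ n, φ (e n) = 0) (w : M)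
    (hw : Tendsto (fun n => ev n w) atTop (𝓝 0)) : φ w = 0 := by
  have key : ∀ ε > 0, ‖φ w‖ ≤ ‖φ‖ * ε := by
    intro ε hε
    obtain ⟨N, hN⟩ := Metric.tendsto_atTop.1 hw ε hε
    have h1 : φ w = φ (w - ∑ n ∈ Finset.range N, ev n w • e n) := by
      rw [map_sub, map_sum]
      simp [hφ]
    rw [h1]
    refine (φ.le_opNorm _).trans (mul_le_mul_of_nonneg_left ?_ (norm_nonneg _))
    refine hev _ _ hε.le fun n => ?_
    rw [map_sub, map_sum]
    simp only [map_smul, he, smul_eq_mul, mul_ite, mul_one, mul_zero, Finset.sum_ite_eq,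
      Finset.mem_range]
    split_ifs with h
    · simpa using hε.le
    · have := hN n (by omega)
      rw [dist_zero_right] at this
      simpa using this.le
  by_contra h
  have hpos : 0 < ‖φ w‖ := norm_pos_iff.2 h
  have hφp : 0 < ‖φ‖ + 1 := by positivity
  have := key (‖φ w‖ / (2 * (‖φ‖ + 1))) (by positivity)
  rw [mul_div_assoc', le_div_iff₀ (by positivity)] at this
  nlinarith [norm_nonneg φ]

/-- Rows sum to one. -/
lemma s_rowsum (d : ℕ → ℕ) (p : ℕ → ℝ) (hd0 : d 0 = 1) (hd : ∀ j, 1 ≤ j → 2 ≤ d j) (n : ℕ) :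
    ∑' m, s d p n m = 1 := by
  have hq1 : ∀ t, 2 ≤ q d (t + 1) := fun t => by
    have := q_strictMono d hd0 hd (show 0 < t + 1 by omega)
    rw [q_zero d hd0] at this
    omega
  have hz1 : 1 ≤ zeta d n := (zeta_iff d hd0 hd n 0).2 (by rw [q_zero d hd0]; exact one_dvd _)
  obtain ⟨Z, hZ⟩ := Nat.exists_eq_add_of_le' hz1
  -- the third part is a finite sum
  have h3 : ∀ m, ∑' t : ℕ, (if q d (t + 1) ∣ m then (PP p (t + 1) - PP p (t + 2)) else 0) *
        (if n = m + q d (t + 1) - 1 then (1 : ℝ) else 0) =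
      ∑ t ∈ Finset.range Z, if m = n + 1 - q d (t + 1) then PP p (t + 1) - PP p (t + 2) else 0 := by
    intro m
    have hcond : ∀ t, (q d (t + 1) ∣ m ∧ n = m + q d (t + 1) - 1) ↔
        (t < Z ∧ m = n + 1 - q d (t + 1)) := by
      intro t
      have hq := hq1 t
      have hzi := zeta_iff d hd0 hd n (t + 1)
      constructor
      · rintro ⟨h1, h2⟩
        have : q d (t + 1) ∣ n + 1 := by
          rw [show n + 1 = m + q d (t + 1) by omega]
          simpa using h1
        have := hzi.2 this
        exact ⟨by omega, by omega⟩
      · rintro ⟨h1, h2⟩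
        have h3 := hzi.1 (by omega)
        have h4 := Nat.le_of_dvd (by omega) h3
        refine ⟨?_, by omega⟩
        rw [h2]
        exact Nat.dvd_sub h3 dvd_rfl
    rw [tsum_eq_sum (s := Finset.range Z)]
    · refine Finset.sum_congr rfl fun t ht => ?_
      have := hcond t
      have ht' : t < Z := Finset.mem_range.1 ht
      by_cases hm : m = n + 1 - q d (t + 1)
      · obtain ⟨a, b⟩ := this.2 ⟨ht', hm⟩
        rw [if_pos a, if_pos b, if_pos hm, mul_one]
      · rw [if_neg hm]
        by_cases a : q d (t + 1) ∣ m
        · rw [if_neg (c := n = _) (fun b => hm (this.1 ⟨a, b⟩).2), mul_zero]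
        · rw [if_neg a, zero_mul]
    · intro t ht
      have := hcond t
      have ht' : ¬ t < Z := fun h => ht (Finset.mem_range.2 h)
      by_cases a : q d (t + 1) ∣ m
      · rw [if_neg (c := n = _) (fun b => ht' (this.1 ⟨a, b⟩).1), mul_zero]
      · rw [if_neg a, zero_mul]
  have hs : ∀ m, s d p n m = (if m = n + 1 then PP p (zeta d n) else 0) +
      (if m = n then 1 - p 1 else 0) +
      ∑ t ∈ Finset.range Z, if m = n + 1 - q d (t + 1) then PP p (t + 1) - PP p (t + 2) else 0 :=
    fun m => by rw [s_eq d p hd0 hd, h3]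
  have hsum : HasSum (s d p n) (PP p (zeta d n) + (1 - p 1) +
      ∑ t ∈ Finset.range Z, (PP p (t + 1) - PP p (t + 2))) := by
    rw [show s d p n = _ from funext hs]
    exact ((hasSum_ite_eq _ _).add (hasSum_ite_eq _ _)).add
      (hasSum_sum fun t _ => hasSum_ite_eq _ _)
  rw [hsum.tsum_eq, Finset.sum_range_sub' (fun t => PP p (t + 1)), hZ]
  have : PP p (0 + 1) = p 1 := by rw [PP_succ, PP_zero, one_mul]
  rw [this]
  ring

/-- evaluation on `c₀`. -/
def evC0 (n : ℕ) : C₀(ℕ, ℂ) →L[ℂ] ℂ :=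
  LinearMap.mkContinuous
    { toFun := fun w => w n
      map_add' := fun _ _ => rfl
      map_smul' := fun _ _ => rfl } 1 (fun w => by
        rw [one_mul, ← ZeroAtInftyContinuousMap.norm_toBCF_eq_norm]
        exact w.toBCF.norm_coe_le_norm n)

/-- unit vectors of `c₀`. -/
def eC0 (m : ℕ) : C₀(ℕ, ℂ) where
  toFun := fun n => if n = m then 1 else 0
  continuous_toFun := continuous_of_discreteTopology
  zero_at_infty' := by
    rw [Filter.cocompact_eq_cofinite, Nat.cofinite_eq_atTop]
    refine tendsto_const_nhds.congr' ?_
    filter_upwards [eventually_gt_atTop m] with n hn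
    rw [if_neg (by omega)]

lemma eC0_apply (n m : ℕ) : evC0 n (eC0 m) = if n = m then 1 else 0 := rfl

/-- evaluation on `c`. -/
def evC (n : ℕ) : C(OnePoint ℕ, ℂ) →L[ℂ] ℂ :=
  LinearMap.mkContinuous
    { toFun := fun w => w (n : OnePoint ℕ)
      map_add' := fun _ _ => rfl
      map_smul' := fun _ _ => rfl } 1 (fun w => by
        rw [one_mul]
        exact w.norm_coe_le_norm n)

/-- unit vectors of `c`. -/
def eC (m : ℕ) : C(OnePoint ℕ, ℂ) :=
  OnePoint.continuousMapMkNat (fun n => if n = m then 1 else 0) 0 (by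
    refine tendsto_const_nhds.congr' ?_
    filter_upwards [eventually_gt_atTop m] with n hn
    rw [if_neg (by omega)])

lemma eC_apply (n m : ℕ) : evC n (eC m) = if n = m then 1 else 0 := rfl

/-- for `Ω ∈ {c₀, c, l^α (1 < α < ∞)}`, the residual spectrum of `S`
on `Ω` is empty. -/
theorem stmt9 (d : ℕ → ℕ) (p : ℕ → ℝ)
    (hd0 : d 0 = 1) (hd : ∀ j, 1 ≤ j → 2 ≤ d j)
    (hp : ∀ j, 1 ≤ j → p j ∈ Set.Ioc (0 : ℝ) 1)
    (α : ℝ≥0∞) [Fact (1 ≤ α)] (hα1 : 1 < α) (hα : α ≠ ⊤)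
    (T0 : C₀(ℕ, ℂ) →L[ℂ] C₀(ℕ, ℂ))
    (hT0 : ∀ (w : C₀(ℕ, ℂ)) (n : ℕ), T0 w n = ∑' m : ℕ, (s d p n m : ℂ) * w m)
    (Tc : C(OnePoint ℕ, ℂ) →L[ℂ] C(OnePoint ℕ, ℂ))
    (hTc : ∀ (w : C(OnePoint ℕ, ℂ)) (n : ℕ),
      Tc w (n : OnePoint ℕ) = ∑' m : ℕ, (s d p n m : ℂ) * w (m : OnePoint ℕ))
    (Ta : lp (fun _ : ℕ => ℂ) α →L[ℂ] lp (fun _ : ℕ => ℂ) α)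
    (hTa : ∀ (w : lp (fun _ : ℕ => ℂ) α) (n : ℕ),
      Ta w n = ∑' m : ℕ, (s d p n m : ℂ) * w m) :
    residualSpectrum T0 = ∅ ∧ residualSpectrum Tc = ∅ ∧ residualSpectrum Ta = ∅ := by
  have hdual : ∀ {M : Type} [NormedAddCommGroup M] [NormedSpace ℂ M] (T : M →L[ℂ] M) (lam : ℂ),
      ¬ DenseRange ⇑(T - lam • (1 : M →L[ℂ] M)) →
      ∃ φ : M →L[ℂ] ℂ, φ ≠ 0 ∧ ∀ w, φ (T w) = lam * φ w := by
    intro M _ _ T lam h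
    obtain ⟨φ, h1, h2⟩ := exists_dual_of_not_dense _ h
    refine ⟨φ, h1, fun w => ?_⟩
    have := h2 w
    simpa [sub_eq_zero] using this
  refine ⟨?_, ?_, ?_⟩
  · rw [Set.eq_empty_iff_forall_notMem]
    rintro lam ⟨-, hnd⟩
    obtain ⟨φ, hφ0, hφ⟩ := hdual T0 lam hnd
    have hev : ∀ (w : C₀(ℕ, ℂ)) (C : ℝ), 0 ≤ C → (∀ n, ‖evC0 n w‖ ≤ C) → ‖w‖ ≤ C := by
      intro w C hC h
      rw [← ZeroAtInftyContinuousMap.norm_toBCF_eq_norm]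
      exact (BoundedContinuousFunction.norm_le hC).2 h
    have hz := key d p hd0 hd hp T0 evC0 (fun w w' h => ZeroAtInftyContinuousMap.ext h) eC0 eC0_apply
      0 (by norm_num) (sup_hnorm evC0 eC0 eC0_apply hev) hT0 φ lam hφ
    apply hφ0
    ext w
    refine sup_zero evC0 eC0 eC0_apply hev φ hz w ?_
    have := w.zero_at_infty'
    rwa [Filter.cocompact_eq_cofinite, Nat.cofinite_eq_atTop] at this
  · rw [Set.eq_empty_iff_forall_notMem]
    rintro lam ⟨hinj, hnd⟩
    obtain ⟨φ, hφ0, hφ⟩ := hdual Tc lam hnd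
    have hdense : DenseRange ((↑) : ℕ → OnePoint ℕ) := OnePoint.denseRange_coe
    have hsep : ∀ w w' : C(OnePoint ℕ, ℂ), (∀ n, evC n w = evC n w') → w = w' := by
      intro w w' h
      apply DFunLike.coe_injective
      exact hdense.equalizer w.continuous w'.continuous (funext h)
    have hev : ∀ (w : C(OnePoint ℕ, ℂ)) (C : ℝ), 0 ≤ C → (∀ n, ‖evC n w‖ ≤ C) → ‖w‖ ≤ C := by
      intro w C hC h
      rw [ContinuousMap.norm_le _ hC]
      intro x
      refine hdense.induction_on (p := fun x => ‖w x‖ ≤ C) x ?_ h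
      exact isClosed_le (by fun_prop) continuous_const
    have hz := key d p hd0 hd hp Tc evC hsep eC eC_apply
      0 (by norm_num) (sup_hnorm evC eC eC_apply hev) hTc φ lam hφ
    have hT1 : Tc 1 = 1 := by
      apply hsep
      intro n
      have h1 : evC n (Tc 1) = ∑' m : ℕ, (s d p n m : ℂ) * 1 := hTc 1 n
      rw [h1]
      change _ = (1 : ℂ)
      simp only [mul_one]
      rw [← Complex.ofReal_tsum, s_rowsum d p hd0 hd]
      simp
    have hlam : lam ≠ 1 := by
      rintro rfl
      have h10 : (1 : C(OnePoint ℕ, ℂ)) = 0 := hinj (by simp [hT1])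
      have := congrArg (fun w : C(OnePoint ℕ, ℂ) => w OnePoint.infty) h10
      simp at this
    have hφ1 : φ 1 = 0 := by
      have := hφ 1
      rw [hT1] at this
      have h2 : (1 - lam) * φ 1 = 0 := by linear_combination this
      rcases mul_eq_zero.1 h2 with h | h
      · exact absurd (sub_eq_zero.1 h).symm hlam
      · exact h
    apply hφ0
    ext w
    have := sup_zero evC eC eC_apply hev φ hz (w - w OnePoint.infty • (1 : C(OnePoint ℕ, ℂ))) ?_
    · rw [map_sub, map_smul, hφ1] at this
      simpa using this
    · have hw := (OnePoint.continuous_iff_from_nat (w : OnePoint ℕ → ℂ)).1 w.continuous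
      have := hw.sub_const (w OnePoint.infty)
      rw [sub_self] at this
      refine this.congr fun n => ?_
      change _ = w n - w OnePoint.infty * 1
      rw [mul_one]
  · rw [Set.eq_empty_iff_forall_notMem]
    rintro lam ⟨-, hnd⟩
    obtain ⟨φ, hφ0, hφ⟩ := hdual Ta lam hnd
    have hα0 : 0 < α := lt_trans zero_lt_one hα1
    have hαr : 1 < α.toReal := by
      rw [← ENNReal.toReal_one]
      exact (ENNReal.toReal_lt_toReal ENNReal.one_ne_top hα).2 hα1
    have hz := key d p hd0 hd hp Ta (fun n => lp.evalCLM ℂ (fun _ : ℕ => ℂ) α n)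
      (fun w w' h => lp.ext (funext h)) (fun n => lp.single α n (1 : ℂ))
      (fun n m => by
        change (lp.single α m (1 : ℂ) : ∀ _ : ℕ, ℂ) n = _
        by_cases h : n = m
        · subst h; simp
        · rw [lp.single_apply_ne _ _ _ h, if_neg h])
      (1 / α.toReal) (by rw [div_lt_one (by linarith)]; exact hαr)
      (fun F c hc => by
        have h1 : ∀ n, c n • lp.single α n (1 : ℂ) = lp.single (E := fun _ : ℕ => ℂ) α n (c n) :=
          fun n => by rw [← lp.single_smul, smul_eq_mul, mul_one]
        simp only [h1]
        have h2 := lp.norm_sum_single (E := fun _ : ℕ => ℂ) (p := α) (by linarith) c F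
        rw [one_div, Real.le_rpow_inv_iff_of_pos (norm_nonneg _) (Nat.cast_nonneg _) (by linarith),
          h2]
        have h3 : ∑ n ∈ F, ‖c n‖ ^ α.toReal ≤ ∑ n ∈ F, 1 :=
          Finset.sum_le_sum fun n _ => Real.rpow_le_one (norm_nonneg _) (hc n) (by linarith)
        simpa using h3)
      hTa φ lam hφ
    apply hφ0
    ext w
    have hs := φ.hasSum (lp.hasSum_single hα w)
    have hzero : ∀ n, φ (lp.single α n (w n)) = 0 := fun n => by
      have h1 : lp.single (E := fun _ : ℕ => ℂ) α n (w n) = w n • lp.single α n (1 : ℂ) := by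
        rw [← lp.single_smul, smul_eq_mul, mul_one]
      rw [h1, map_smul, hz n, smul_zero]
    simp only [hzero] at hs
    exact hs.unique hasSum_zero

end AMFC
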